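/- arXiv:1505.00666 — 3 statements merged into one kernel-verified Lean document; each statement's English description precedes it below -/
import Mathlib

section
/- For d ≥ 3 and f = x^d + y^{d−1}z ∈ ℂ[x,y,z], the residue classes modulo J_f of the d−1 monomials y^{d−2}, x·y^{d−2}, x²·y^{d−2}, ..., x^{d−2}·y^{d−2} form a ℂ-vector space basis of the Jacobian module N(f) = I_f/J_f. -/
open MvPolynomial

noncomputable section

/-- The polynomial ring `S = ℂ[x,y,z]`. -/
abbrev S : Type := MvPolynomial (Fin 3) ℂ

/-- The Jacobian ideal of `f`, spanned by the three partial derivatives. -/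
def Jf (f : S) : Ideal S := Ideal.span {pderiv 0 f, pderiv 1 f, pderiv 2 f}

/-- The irrelevant maximal ideal `m = (x,y,z)`. -/
def mId : Ideal S := Ideal.span {X 0, X 1, X 2}

/-- The saturation `I_f` of the Jacobian ideal with respect to `m`. -/
def Isat (f : S) : Ideal S := ⨆ n : ℕ, Submodule.colon (Jf f) ((mId ^ n : Ideal S) : Submodule S S)

/-- The quotient map `S → M(f) = S/J_f`, as a `ℂ`-linear map. -/
def quotC (f : S) : S →ₗ[ℂ] (S ⧸ (Jf f : Submodule S S)) :=
  ((Jf f : Submodule S S).mkQ).restrictScalars ℂ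

/-- Degree-`k` homogeneous component of `S`, as a `ℂ`-subspace. -/
def Sgr (k : ℕ) : Submodule ℂ S := homogeneousSubmodule (Fin 3) ℂ k

/-- The degree-`k` part of the Milnor algebra `M(f)`. -/
def Msub (f : S) (k : ℕ) : Submodule ℂ (S ⧸ (Jf f : Submodule S S)) := (Sgr k).map (quotC f)

/-- `m(f)_k`, the dimension of the degree-`k` part of the Milnor algebra. -/
def mdim (f : S) (k : ℕ) : ℕ := Module.finrank ℂ (Msub f k)

/-- The degree-`k` part of the Jacobian module `N(f) = I_f/J_f`, realized inside `S/J_f`. -/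
def Nsub (f : S) (k : ℕ) : Submodule ℂ (S ⧸ (Jf f : Submodule S S)) :=
  (((Isat f).restrictScalars ℂ) ⊓ Sgr k).map (quotC f)

/-- `dim_ℂ N(f)_k`. -/
def ndim (f : S) (k : ℕ) : ℕ := Module.finrank ℂ (Nsub f k)

/-- The Jacobian module `N(f) = I_f/J_f`, as an `S`-submodule of `S/J_f`. -/
def Nmod (f : S) : Submodule S (S ⧸ (Jf f : Submodule S S)) :=
  Submodule.map ((Jf f : Submodule S S).mkQ) (Isat f : Submodule S S)

/-- The Jacobian module `N(f)` as a `ℂ`-subspace of `S/J_f`. -/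
def NsubTot (f : S) : Submodule ℂ (S ⧸ (Jf f : Submodule S S)) :=
  ((Isat f).restrictScalars ℂ).map (quotC f)

/-- `dim_ℂ N(f)`. -/
def ndimTot (f : S) : ℕ := Module.finrank ℂ (NsubTot f)

/-- `C : f = 0` is nearly free: `N(f) ≠ 0` and `dim N(f)_k ≤ 1` for all `k`. -/
def NearlyFree (f : S) : Prop := Nmod f ≠ ⊥ ∧ ∀ k : ℕ, ndim f k ≤ 1

/-- `f` defines a union of lines passing through one point. -/
def IsConeOfLines (f : S) : Prop :=
  ∃ q : Fin 3 → ℂ, q ≠ 0 ∧ ∃ (c : ℂ) (L : Multiset S),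
    (∀ l ∈ L, l ∈ Sgr 1 ∧ eval q l = 0) ∧ f = C c * L.prod

/-- The defining equation map `(a,b,c) ↦ a f_x + b f_y + c f_z`. -/
def eqnMap (f : S) : (Fin 3 → S) →ₗ[S] S where
  toFun r := ∑ i, r i * pderiv i f
  map_add' a b := by simp [add_mul, Finset.sum_add_distrib]
  map_smul' c a := by simp [Finset.mul_sum, mul_assoc]

/-- `AR(f)`, the module of all relations among the partial derivatives of `f`. -/
def ARmod (f : S) : Submodule S (Fin 3 → S) := LinearMap.ker (eqnMap f)

/-- A triple of polynomials is homogeneous of degree `m` (componentwise). -/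
def IsHomRel (r : Fin 3 → S) (m : ℕ) : Prop := ∀ i, r i ∈ Sgr m

/-- The set of degrees of nonzero homogeneous relations in `AR(f)`;
its least element is `mdr(f)`. -/
def mdrSet (f : S) : Set ℕ := {m | ∃ r ∈ ARmod f, r ≠ 0 ∧ IsHomRel r m}

/-- The map `(u₁,u₂,u₃) ↦ u₁ r₁ + u₂ r₂ + u₃ r₃` whose kernel is the syzygy
module among `r₁, r₂, r₃`. -/
def syzMap (r : Fin 3 → (Fin 3 → S)) : (Fin 3 → S) →ₗ[S] (Fin 3 → S) where
  toFun u := ∑ j, u j • r j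
  map_add' a b := by simp [add_smul, Finset.sum_add_distrib]
  map_smul' c a := by simp [Finset.smul_sum, smul_smul]

/-- `M(f)` has a minimal graded free resolution
`0 → S(−b−2(d−1)) → ⊕ᵢ S(−dᵢ−(d−1)) → S(−d+1)³ → S`; equivalently, `AR(f)` is
generated by three homogeneous relations of degrees `d₁, d₂, d₃`, none lying in
the submodule spanned by the other two, whose syzygy module is free of rank one,
generated by a homogeneous triple `(v₁,v₂,v₃)` with `deg vᵢ = b − dᵢ + d − 1`. -/
def HasResolution (f : S) (d : ℕ) (dd : Fin 3 → ℕ) (b : ℤ) : Prop :=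
  ∃ r : Fin 3 → (Fin 3 → S),
    (∀ j, r j ∈ ARmod f) ∧
    (∀ j, IsHomRel (r j) (dd j)) ∧
    Submodule.span S (Set.range r) = ARmod f ∧
    (∀ j, r j ∉ Submodule.span S (r '' {k | k ≠ j})) ∧
    ∃ v : Fin 3 → S, v ≠ 0 ∧
      (∀ j, ∃ e : ℕ, (e : ℤ) = b - dd j + d - 1 ∧ v j ∈ Sgr e) ∧
      LinearMap.ker (syzMap r) = Submodule.span S {v}

/-- The Hilbert function of the Milnor algebra of a smooth plane curve of
degree `d`: the coefficient of `t^k` in `((1 − t^{d−1})/(1 − t))³`. -/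
def msHilb (d k : ℕ) : ℕ :=
  (((∑ i ∈ Finset.range (d - 1), (Polynomial.X : Polynomial ℕ) ^ i)) ^ 3).coeff k

/-- `τ` is the total Tjurina number of `C : f = 0`, i.e. the common value of
`m(f)_k` for all sufficiently large `k`. -/
def TjurinaIs (f : S) (τ : ℕ) : Prop := ∃ N : ℕ, ∀ k ≥ N, mdim f k = τ


lemma aux_memJ (d : ℕ) (hd : 3 ≤ d) (f : S)
    (hf : f = X 0 ^ d + X 1 ^ (d - 1) * X 2) (p : S) :
    p ∈ Jf f ↔ ∀ m ∈ p.support,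
      d - 1 ≤ m 0 ∨ (d - 2 ≤ m 1 ∧ 1 ≤ m 2) ∨ d - 1 ≤ m 1 := by
  have hJ : Jf f = Ideal.span ((fun s => monomial s (1 : ℂ)) ''
      ({Finsupp.single 0 (d - 1), Finsupp.single 1 (d - 2) + Finsupp.single 2 1,
        Finsupp.single 1 (d - 1)} : Set (Fin 3 →₀ ℕ))) := by
    have e0 : pderiv 0 f = C (d : ℂ) * X 0 ^ (d - 1) := by
      subst hf
      simp [Derivation.leibniz, Derivation.leibniz_pow, pderiv_X]
    have e1 : pderiv 1 f = C ((d - 1 : ℕ) : ℂ) * (X 1 ^ (d - 2) * X 2) := by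
      subst hf
      simp [Derivation.leibniz, Derivation.leibniz_pow, pderiv_X, Nat.sub_sub]
      ring
    have e2 : pderiv 2 f = X 1 ^ (d - 1) := by
      subst hf
      simp [Derivation.leibniz, Derivation.leibniz_pow, pderiv_X]
    have u0 : IsUnit (C (d : ℂ) : S) :=
      (IsUnit.mk0 (d : ℂ) (Nat.cast_ne_zero.2 (by omega))).map C
    have u1 : IsUnit (C ((d - 1 : ℕ) : ℂ) : S) :=
      (IsUnit.mk0 ((d - 1 : ℕ) : ℂ) (Nat.cast_ne_zero.2 (by omega))).map C
    have m0 : monomial (Finsupp.single (0 : Fin 3) (d - 1)) (1 : ℂ) = X 0 ^ (d - 1) := by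
      rw [X_pow_eq_monomial]
    have m1 : monomial (Finsupp.single (1 : Fin 3) (d - 2) + Finsupp.single 2 1) (1 : ℂ)
        = X 1 ^ (d - 2) * X 2 := by
      rw [X_pow_eq_monomial, X, monomial_mul, one_mul]
    have m2 : monomial (Finsupp.single (1 : Fin 3) (d - 1)) (1 : ℂ) = X 1 ^ (d - 1) := by
      rw [X_pow_eq_monomial]
    rw [Jf, e0, e1, e2, Set.image_insert_eq, Set.image_pair, m0, m1, m2]
    simp only [Ideal.span_insert, Ideal.span_singleton_mul_left_unit u0,
      Ideal.span_singleton_mul_left_unit u1]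
  rw [hJ, mem_ideal_span_monomial_image]
  refine forall₂_congr fun m _ => ?_
  simp [Finsupp.le_def, Fin.forall_fin_succ]

lemma aux_Isat_le (d : ℕ) (hd : 3 ≤ d) (f : S)
    (hf : f = X 0 ^ d + X 1 ^ (d - 1) * X 2) (p : S) (hp : p ∈ Isat f) :
    ∀ m ∈ p.support, d - 1 ≤ m 0 ∨ d - 2 ≤ m 1 := by
  let I : Ideal S := Ideal.span ((fun s => monomial s (1 : ℂ)) ''
      ({Finsupp.single 0 (d - 1), Finsupp.single 1 (d - 2)} : Set (Fin 3 →₀ ℕ)))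
  have hI : ∀ q : S, q ∈ I ↔ ∀ m ∈ q.support, d - 1 ≤ m 0 ∨ d - 2 ≤ m 1 := by
    intro q
    rw [mem_ideal_span_monomial_image]
    refine forall₂_congr fun m _ => ?_
    simp
  rw [← hI]
  refine (iSup_le ?_ : Isat f ≤ I) hp
  intro n q hq
  rw [hI]
  intro m hm
  have hz : (X 2 ^ n : S) ∈ mId ^ n :=
    Ideal.pow_mem_pow (Ideal.subset_span (by simp)) n
  have h := Submodule.mem_colon.1 hq _ hz
  rw [smul_eq_mul, aux_memJ d hd f hf] at h
  have h2 := h (m + Finsupp.single 2 n) (by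
    rw [mem_support_iff, X_pow_eq_monomial, coeff_mul_monomial, mul_one]
    exact mem_support_iff.1 hm)
  simp at h2
  omega

lemma aux_mem_Isat (d : ℕ) (hd : 3 ≤ d) (f : S)
    (hf : f = X 0 ^ d + X 1 ^ (d - 1) * X 2) : (X 1 ^ (d - 2) : S) ∈ Isat f := by
  have key : ∀ m : Fin 3 →₀ ℕ, (d - 1 ≤ m 0 ∨ (d - 2 ≤ m 1 ∧ 1 ≤ m 2) ∨ d - 1 ≤ m 1) →
      monomial m (1 : ℂ) ∈ Jf f := by
    intro m hm
    rw [aux_memJ d hd f hf]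
    intro m' hm'
    have := support_monomial_subset hm'
    rw [Finset.mem_singleton] at this
    exact this ▸ hm
  refine (le_iSup (fun n : ℕ => Submodule.colon (Jf f)
    ((mId ^ n : Ideal S) : Submodule S S)) (d - 1 + 1)) ?_
  let K : Ideal S := Submodule.colon (Jf f) ({X 1 ^ (d - 2)} : Set S)
  have hK : ∀ q : S, q ∈ K ↔ q * X 1 ^ (d - 2) ∈ Jf f := by
    intro q
    simp [K, Submodule.mem_colon]
  have hle : mId ^ (d - 1 + 1) ≤ K := by
    have hm : mId = Ideal.span {X 0} ⊔ Ideal.span {X 1, X 2} := by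
      rw [mId, Ideal.span_insert]
    rw [hm]
    refine (Ideal.sup_pow_add_le_pow_sup_pow).trans (sup_le ?_ ?_)
    · rw [Ideal.span_singleton_pow, Ideal.span_singleton_le_iff_mem, hK, X_pow_eq_monomial,
        X_pow_eq_monomial, monomial_mul, one_mul]
      exact key _ (by simp)
    · rw [pow_one, Ideal.span_le]
      rintro q (rfl | rfl)
      · rw [SetLike.mem_coe, hK, X_pow_eq_monomial, X, monomial_mul, one_mul]
        exact key _ (by simp; omega)
      · rw [SetLike.mem_coe, hK, X_pow_eq_monomial, X, monomial_mul, one_mul]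
        exact key _ (by simp)
  rw [Submodule.mem_colon]
  intro q hq
  rw [smul_eq_mul, mul_comm, ← hK]
  exact hle hq

lemma aux_mon (d i : ℕ) : (X 0 ^ i * X 1 ^ (d - 2) : S)
    = monomial (Finsupp.single 0 i + Finsupp.single 1 (d - 2)) 1 := by
  rw [X_pow_eq_monomial, X_pow_eq_monomial, monomial_mul, one_mul]

theorem stmt16 (d : ℕ) (hd : 3 ≤ d) (f : S)
    (hf : f = X 0 ^ d + X 1 ^ (d - 1) * X 2) :
    LinearIndependent ℂ (fun i : Fin (d - 1) => quotC f (X 0 ^ (i : ℕ) * X 1 ^ (d - 2))) ∧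
    Submodule.span ℂ
        (Set.range (fun i : Fin (d - 1) => quotC f (X 0 ^ (i : ℕ) * X 1 ^ (d - 2))))
      = NsubTot f := by
  have hq : ∀ p : S, quotC f p = 0 ↔ p ∈ Jf f := by
    intro p
    exact Submodule.Quotient.mk_eq_zero (Jf f)
  constructor
  · rw [Fintype.linearIndependent_iff]
    intro g hg i
    by_contra hi
    simp only [← map_smul, ← map_sum] at hg
    rw [hq, aux_memJ d hd f hf] at hg
    have h := hg (Finsupp.single 0 (i : ℕ) + Finsupp.single 1 (d - 2)) (by
      rw [mem_support_iff, coeff_sum, Finset.sum_eq_single i]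
      · rw [aux_mon, coeff_smul, coeff_monomial, if_pos rfl]
        simpa using hi
      · intro j _ hj
        rw [aux_mon, coeff_smul, coeff_monomial, if_neg, smul_zero]
        intro h
        have := DFunLike.congr_fun h 0
        simp at this
        exact hj (Fin.ext this)
      · simp)
    have := i.2
    simp at h
    omega
  · apply le_antisymm
    · rw [Submodule.span_le]
      rintro _ ⟨i, rfl⟩
      exact Submodule.mem_map_of_mem (Ideal.mul_mem_left _ _ (aux_mem_Isat d hd f hf))
    · rintro _ ⟨p, hp, rfl⟩
      have hs := aux_Isat_le d hd f hf p hp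
      rw [p.as_sum, map_sum]
      refine Submodule.sum_mem _ fun m hm => ?_
      by_cases hJ : d - 1 ≤ m 0 ∨ (d - 2 ≤ m 1 ∧ 1 ≤ m 2) ∨ d - 1 ≤ m 1
      · have : quotC f (monomial m (coeff m p)) = 0 := by
          rw [hq, aux_memJ d hd f hf]
          intro m' hm'
          have := support_monomial_subset hm'
          rw [Finset.mem_singleton] at this
          exact this ▸ hJ
        rw [this]
        exact Submodule.zero_mem _
      · have h1 := hs m hm
        have h2 : m = Finsupp.single 0 (m 0) + Finsupp.single 1 (d - 2) := by
          ext k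
          fin_cases k <;> simp <;> omega
        have h3 : monomial m (coeff m p) = coeff m p • (X 0 ^ (m 0) * X 1 ^ (d - 2) : S) := by
          rw [aux_mon, ← h2, smul_monomial, smul_eq_mul, mul_one]
        rw [h3, map_smul]
        refine Submodule.smul_mem _ _ (Submodule.subset_span ⟨⟨m 0, by omega⟩, rfl⟩)

end
end

section
/- For integers d ≥ 4 and 2 ≤ k ≤ d/2, the curve C_d : f = x^d − y^{d−k}z^k = 0 is nearly free: dim_ℂ N(f)_j = 1 for d−2 ≤ j ≤ 2d−4 and N(f)_j = 0 for all other j. Moreover its total Tjurina number is τ(C_d) = (d−1)(d−2), i.e. m(f)_j = (d−1)(d−2) for all sufficiently large j. -/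
open MvPolynomial

noncomputable section

lemma quotC_eq_zero (f u : S) : quotC f u = 0 ↔ u ∈ Jf f := by
  simp only [quotC, LinearMap.restrictScalars_apply, Submodule.mkQ_apply]
  exact Submodule.Quotient.mk_eq_zero _

lemma mem_supp_monomial {e e' : Fin 3 →₀ ℕ} {c : ℂ} (h : e' ∈ (monomial e c : S).support) :
    e' = e := by
  simpa using MvPolynomial.support_monomial_subset h

lemma dimlem (f : S) (E : Set (Fin 3 →₀ ℕ)) (hJ : ∀ u, u ∈ Jf f ↔ ∀ e ∈ u.support, e ∈ E)
    (V : Submodule ℂ S) (P : Set (Fin 3 →₀ ℕ)) (hV : ∀ u, u ∈ V ↔ ∀ e ∈ u.support, e ∈ P)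
    (hfin : (P \ E).Finite) :
    Module.finrank ℂ (V.map (quotC f)) = (P \ E).ncard := by
  have := hfin.fintype
  let v : ↥(P \ E) → S := fun e => monomial (e : Fin 3 →₀ ℕ) (1 : ℂ)
  have hli : LinearIndependent ℂ v := by
    have h := (basisMonomials (Fin 3) ℂ).linearIndependent
    have h2 := h.comp (fun e : ↥(P \ E) => (e : Fin 3 →₀ ℕ)) Subtype.val_injective
    have h3 : v = (⇑(basisMonomials (Fin 3) ℂ)) ∘ (fun e : ↥(P \ E) => (e : Fin 3 →₀ ℕ)) := by
      funext e
      simp [v]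
    rw [h3]; exact h2
  have hspan : Submodule.span ℂ (Set.range v) = restrictSupport ℂ (P \ E) := by
    rw [restrictSupport_eq_span]
    congr 1
    ext u
    simp [v]
  have hli2 : LinearIndependent ℂ (⇑(quotC f) ∘ v) := by
    refine hli.map ?_
    rw [Submodule.disjoint_def]
    intro u hu hk
    rw [hspan, mem_restrictSupport_iff] at hu
    rw [LinearMap.mem_ker, quotC_eq_zero, hJ] at hk
    rw [← MvPolynomial.support_eq_empty, Finset.eq_empty_iff_forall_notMem]
    intro e he
    exact (hu he).2 (hk e he)
  have heq : V.map (quotC f) = Submodule.span ℂ (Set.range (⇑(quotC f) ∘ v)) := by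
    apply le_antisymm
    · rintro _ ⟨u, hu, rfl⟩
      have hu' := (hV u).1 hu
      rw [u.as_sum, map_sum]
      refine Submodule.sum_mem _ fun e he => ?_
      by_cases hE : e ∈ E
      · have : quotC f (monomial e (coeff e u)) = 0 := by
          rw [quotC_eq_zero, hJ]
          intro e' he'
          rw [mem_supp_monomial he']; exact hE
        rw [this]; exact Submodule.zero_mem _
      · have : (monomial e (coeff e u) : S) = coeff e u • monomial e (1 : ℂ) := by
          rw [smul_monomial]; simp
        rw [this, map_smul]
        exact Submodule.smul_mem _ _ (Submodule.subset_span ⟨⟨e, hu' e he, hE⟩, rfl⟩)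
    · rw [Submodule.span_le]
      rintro _ ⟨e, rfl⟩
      refine ⟨v e, ?_, rfl⟩
      refine (hV _).2 fun e' he' => ?_
      rw [mem_supp_monomial he']; exact e.2.1
  rw [heq, finrank_span_eq_card hli2, Set.ncard_eq_toFinset_card', Set.toFinset_card]

/-- exponent vectors -/
def ex (i p q : ℕ) : Fin 3 →₀ ℕ := Finsupp.equivFunOnFinite.symm ![i, p, q]

@[simp] lemma ex0 (i p q : ℕ) : ex i p q 0 = i := rfl
@[simp] lemma ex1 (i p q : ℕ) : ex i p q 1 = p := rfl
@[simp] lemma ex2 (i p q : ℕ) : ex i p q 2 = q := rfl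

lemma ex_ext (e e' : Fin 3 →₀ ℕ) (h0 : e 0 = e' 0) (h1 : e 1 = e' 1) (h2 : e 2 = e' 2) :
    e = e' := by
  ext i; fin_cases i <;> assumption

lemma ex_le (i p q : ℕ) (e : Fin 3 →₀ ℕ) : ex i p q ≤ e ↔ i ≤ e 0 ∧ p ≤ e 1 ∧ q ≤ e 2 := by
  constructor
  · intro h; exact ⟨h 0, h 1, h 2⟩
  · rintro ⟨h0, h1, h2⟩ i; fin_cases i <;> assumption

lemma mon_ex (i p q : ℕ) : (monomial (ex i p q) (1 : ℂ) : S) = X 0 ^ i * X 1 ^ p * X 2 ^ q := by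
  rw [monomial_eq, Finsupp.prod_fintype _ _ (by simp), Fin.prod_univ_three]
  simp

lemma mem_Sgr (j : ℕ) (u : S) : u ∈ Sgr j ↔ ∀ e ∈ u.support, e 0 + e 1 + e 2 = j := by
  have : ∀ e : Fin 3 →₀ ℕ, e 0 + e 1 + e 2 = e.degree := fun e => by
    rw [Finsupp.degree_eq_sum, Fin.sum_univ_three]
  simp only [Sgr, this]
  rw [homogeneousSubmodule_eq_finsupp_supported]
  rfl

lemma span_unit (A B C' : S) (α β γ : ℂ) (hα : α ≠ 0) (hβ : β ≠ 0) (hγ : γ ≠ 0) :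
    Ideal.span {C α * A, C β * B, C γ * C'} = Ideal.span {A, B, C'} := by
  have key : ∀ (I : Ideal S) (c : ℂ) (hc : c ≠ 0) (a : S), C c * a ∈ I ↔ a ∈ I := by
    intro I c hc a
    refine ⟨fun h => ?_, fun h => I.mul_mem_left _ h⟩
    have := I.mul_mem_left (C c⁻¹) h
    rwa [← mul_assoc, ← C_mul, inv_mul_cancel₀ hc, C_1, one_mul] at this
  apply le_antisymm
  · rw [Ideal.span_le]
    rintro u (rfl | rfl | rfl) <;>
    exact Ideal.mul_mem_left _ _ (Ideal.subset_span (by simp))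
  · rw [Ideal.span_le]
    rintro u (rfl | rfl | rfl)
    · exact (key _ _ hα _).1 (Ideal.subset_span (by simp))
    · exact (key _ _ hβ _).1 (Ideal.subset_span (by simp))
    · exact (key _ _ hγ _).1 (Ideal.subset_span (by simp))

lemma Jf_mem (d k : ℕ) (hd : 4 ≤ d) (hk2 : 2 ≤ k) (hkd : 2 * k ≤ d) (f : S)
    (hf : f = X 0 ^ d - X 1 ^ (d - k) * X 2 ^ k) (u : S) :
    u ∈ Jf f ↔ ∀ e ∈ u.support, e ∈ {e : Fin 3 →₀ ℕ | d - 1 ≤ e 0 ∨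
      (d - k - 1 ≤ e 1 ∧ k ≤ e 2) ∨ (d - k ≤ e 1 ∧ k - 1 ≤ e 2)} := by
  have h0 : pderiv 0 f = C (d : ℂ) * monomial (ex (d - 1) 0 0) 1 := by
    rw [hf, mon_ex]; simp [pderiv_X, Pi.single_apply]
  have h1 : pderiv 1 f = C (-((d - k : ℕ) : ℂ)) * monomial (ex 0 (d - k - 1) k) 1 := by
    rw [hf, mon_ex]; simp [pderiv_X, Pi.single_apply]; ring
  have h2 : pderiv 2 f = C (-(k : ℂ)) * monomial (ex 0 (d - k) (k - 1)) 1 := by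
    rw [hf, mon_ex]; simp [pderiv_X, Pi.single_apply]; ring
  have hJ : Jf f = Ideal.span ((fun s => monomial s (1 : ℂ)) ''
      {ex (d - 1) 0 0, ex 0 (d - k - 1) k, ex 0 (d - k) (k - 1)}) := by
    rw [Jf, h0, h1, h2, span_unit]
    · simp [Set.image_insert_eq]
    · exact_mod_cast (by omega : d ≠ 0)
    · exact neg_ne_zero.2 (by exact_mod_cast (by omega : d - k ≠ 0))
    · exact neg_ne_zero.2 (by exact_mod_cast (by omega : k ≠ 0))
  rw [hJ, mem_ideal_span_monomial_image]
  simp [ex_le]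

lemma mId_eq : mId = idealOfVars (Fin 3) ℂ := by
  rw [mId, idealOfVars]
  congr 1
  ext u
  simp [Fin.exists_fin_succ, eq_comm]

lemma mon_shift (I : Ideal S) (E : Set (Fin 3 →₀ ℕ)) (hI : ∀ u, u ∈ I ↔ ∀ e ∈ u.support, e ∈ E)
    (u : S) (s : Fin 3 →₀ ℕ) (h : u * monomial s (1 : ℂ) ∈ I) (e : Fin 3 →₀ ℕ)
    (he : e ∈ u.support) : e + s ∈ E := by
  refine (hI _).1 h _ ?_
  rw [mem_support_iff, coeff_mul_monomial, mul_one]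
  exact mem_support_iff.1 he

lemma Isat_mem (d k : ℕ) (hd : 4 ≤ d) (hk2 : 2 ≤ k) (hkd : 2 * k ≤ d) (f : S)
    (hf : f = X 0 ^ d - X 1 ^ (d - k) * X 2 ^ k) (u : S) :
    u ∈ Isat f ↔ ∀ e ∈ u.support, e ∈ {e : Fin 3 →₀ ℕ | d - 1 ≤ e 0 ∨
      (d - k - 1 ≤ e 1 ∧ k - 1 ≤ e 2)} := by
  have hJ := Jf_mem d k hd hk2 hkd f hf
  have hI : ∀ u : S, u ∈ Ideal.span ((fun s => monomial s (1 : ℂ)) ''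
      {ex (d - 1) 0 0, ex 0 (d - k - 1) (k - 1)}) ↔ ∀ e ∈ u.support,
      e ∈ {e : Fin 3 →₀ ℕ | d - 1 ≤ e 0 ∨ (d - k - 1 ≤ e 1 ∧ k - 1 ≤ e 2)} := by
    intro u
    rw [mem_ideal_span_monomial_image]
    simp [ex_le]
  constructor
  · intro h
    rw [← hI]
    revert u
    change Isat f ≤ _
    refine iSup_le fun n => ?_
    intro u hu
    rw [Submodule.mem_colon] at hu
    rw [hI]
    intro e he
    have hy := hu (X 1 ^ n) (Ideal.pow_mem_pow (Ideal.subset_span (by simp)) n)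
    have hz := hu (X 2 ^ n) (Ideal.pow_mem_pow (Ideal.subset_span (by simp)) n)
    have ey : (X 1 ^ n : S) = monomial (ex 0 n 0) 1 := by rw [mon_ex]; simp
    have ez : (X 2 ^ n : S) = monomial (ex 0 0 n) 1 := by rw [mon_ex]; simp
    rw [ey, smul_eq_mul] at hy
    rw [ez, smul_eq_mul] at hz
    have hy' := mon_shift _ _ hJ u _ hy e he
    have hz' := mon_shift _ _ hJ u _ hz e he
    simp only [Set.mem_ofPred_eq, Finsupp.add_apply, ex0, ex1, ex2] at hy' hz' ⊢
    omega
  · intro h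
    refine (le_iSup (fun n : ℕ => Submodule.colon (Jf f)
      ((mId ^ n : Ideal S) : Submodule S S)) d) ?_
    rw [Submodule.mem_colon]
    intro s hs
    rw [smul_eq_mul, hJ]
    intro e he
    classical
    obtain ⟨a, ha, b, hb, rfl⟩ := Finset.mem_add.1 (support_mul _ _ he)
    have h1 := h a ha
    have hs' : s ∈ idealOfVars (Fin 3) ℂ ^ d := by rw [← mId_eq]; exact hs
    rw [mem_pow_idealOfVars_iff] at hs'
    have h2 := hs' b hb
    simp only [Finsupp.degree_eq_sum, Fin.sum_univ_three] at h2
    simp only [Set.mem_ofPred_eq, Finsupp.add_apply] at h1 h2 ⊢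
    omega

lemma ndim_eq (d k : ℕ) (hd : 4 ≤ d) (hk2 : 2 ≤ k) (hkd : 2 * k ≤ d) (f : S)
    (hf : f = X 0 ^ d - X 1 ^ (d - k) * X 2 ^ k) (j : ℕ) :
    (d - 2 ≤ j ∧ j ≤ 2 * d - 4 → ndim f j = 1) ∧
      ((j < d - 2 ∨ 2 * d - 4 < j) → ndim f j = 0) := by
  have hV : ∀ u, u ∈ ((Isat f).restrictScalars ℂ) ⊓ Sgr j ↔ ∀ e ∈ u.support,
      e ∈ {e : Fin 3 →₀ ℕ | (d - 1 ≤ e 0 ∨ (d - k - 1 ≤ e 1 ∧ k - 1 ≤ e 2)) ∧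
        e 0 + e 1 + e 2 = j} := by
    intro u
    rw [Submodule.mem_inf, mem_Sgr, Submodule.restrictScalars_mem,
      Isat_mem d k hd hk2 hkd f hf, ← forall₂_and]
    rfl
  have hJ := Jf_mem d k hd hk2 hkd f hf
  constructor
  · intro hj
    have hs : {e : Fin 3 →₀ ℕ | (d - 1 ≤ e 0 ∨ (d - k - 1 ≤ e 1 ∧ k - 1 ≤ e 2)) ∧
        e 0 + e 1 + e 2 = j} \ {e : Fin 3 →₀ ℕ | d - 1 ≤ e 0 ∨
      (d - k - 1 ≤ e 1 ∧ k ≤ e 2) ∨ (d - k ≤ e 1 ∧ k - 1 ≤ e 2)} =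
        {ex (j - (d - 2)) (d - k - 1) (k - 1)} := by
      ext e
      simp only [Set.mem_sdiff, Set.mem_ofPred_eq, Set.mem_singleton_iff]
      constructor
      · intro h
        apply ex_ext <;> simp only [ex0, ex1, ex2] <;> omega
      · rintro rfl
        simp only [ex0, ex1, ex2]; omega
    have := dimlem f _ hJ _ _ hV (by rw [hs]; exact Set.finite_singleton _)
    rw [hs, Set.ncard_singleton] at this
    exact this
  · intro hj
    have hs : {e : Fin 3 →₀ ℕ | (d - 1 ≤ e 0 ∨ (d - k - 1 ≤ e 1 ∧ k - 1 ≤ e 2)) ∧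
        e 0 + e 1 + e 2 = j} \ {e : Fin 3 →₀ ℕ | d - 1 ≤ e 0 ∨
      (d - k - 1 ≤ e 1 ∧ k ≤ e 2) ∨ (d - k ≤ e 1 ∧ k - 1 ≤ e 2)} = ∅ := by
      ext e
      simp only [Set.mem_sdiff, Set.mem_ofPred_eq, Set.mem_empty_iff_false, iff_false]
      intro h; omega
    have := dimlem f _ hJ _ _ hV (by rw [hs]; exact Set.finite_empty)
    rw [hs, Set.ncard_empty] at this
    exact this

lemma mdim_eq (d k : ℕ) (hd : 4 ≤ d) (hk2 : 2 ≤ k) (hkd : 2 * k ≤ d) (f : S)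
    (hf : f = X 0 ^ d - X 1 ^ (d - k) * X 2 ^ k) (j : ℕ) (hj : 3 * d ≤ j) :
    mdim f j = (d - 1) * (d - 2) := by
  have hJ := Jf_mem d k hd hk2 hkd f hf
  let g : ℕ × ℕ → (Fin 3 →₀ ℕ) := fun x =>
    if x.2 < d - k - 1 then ex x.1 x.2 (j - x.1 - x.2)
    else ex x.1 (j - x.1 - (x.2 - (d - k - 1))) (x.2 - (d - k - 1))
  have hs : {e : Fin 3 →₀ ℕ | e 0 + e 1 + e 2 = j} \ {e : Fin 3 →₀ ℕ | d - 1 ≤ e 0 ∨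
      (d - k - 1 ≤ e 1 ∧ k ≤ e 2) ∨ (d - k ≤ e 1 ∧ k - 1 ≤ e 2)} =
      g '' ↑(Finset.range (d - 1) ×ˢ Finset.range (d - 2)) := by
    ext e
    simp only [Set.mem_sdiff, Set.mem_ofPred_eq, Set.mem_image, Finset.mem_coe, Finset.mem_product,
      Finset.mem_range]
    constructor
    · intro h
      by_cases hc : e 1 < d - k - 1
      · refine ⟨(e 0, e 1), ⟨by simp only; omega, by simp only; omega⟩, ?_⟩
        simp only [g, if_pos hc]
        apply ex_ext <;> simp only [ex0, ex1, ex2]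
        omega
      · have hc2 : ¬ (e 2 + (d - k - 1) < d - k - 1) := by omega
        refine ⟨(e 0, e 2 + (d - k - 1)), ⟨by simp only; omega, by simp only; omega⟩, ?_⟩
        simp only [g, if_neg hc2]
        apply ex_ext <;> simp only [ex0, ex1, ex2] <;> omega
    · rintro ⟨⟨i, p⟩, ⟨h1, h2⟩, rfl⟩
      simp only at h1 h2
      by_cases hc : p < d - k - 1
      · simp only [g, if_pos hc, ex0, ex1, ex2]; omega
      · simp only [g, if_neg hc, ex0, ex1, ex2]; omega
  have hinj : Set.InjOn g ↑(Finset.range (d - 1) ×ˢ Finset.range (d - 2)) := by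
    rintro ⟨i, p⟩ h ⟨i', p'⟩ h' hg
    simp only [Finset.mem_coe, Finset.mem_product, Finset.mem_range] at h h'
    have g0 := DFunLike.congr_fun hg 0
    have g1 := DFunLike.congr_fun hg 1
    have g2 := DFunLike.congr_fun hg 2
    simp only [g] at g0 g1 g2
    rw [Prod.mk.injEq]
    split_ifs at g0 g1 g2 <;> simp only [ex0, ex1, ex2] at g0 g1 g2 <;> omega
  have := dimlem f _ hJ (Sgr j) _ (mem_Sgr j) (by
    change (_ \ _ : Set _).Finite
    erw [hs]; exact (Finset.finite_toSet _).image _)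
  have h2 : mdim f j = ({e : Fin 3 →₀ ℕ | e 0 + e 1 + e 2 = j} \ {e : Fin 3 →₀ ℕ | d - 1 ≤ e 0 ∨
      (d - k - 1 ≤ e 1 ∧ k ≤ e 2) ∨ (d - k ≤ e 1 ∧ k - 1 ≤ e 2)}).ncard := this
  rw [h2, hs, hinj.ncard_image, Set.ncard_coe_finset, Finset.card_product, Finset.card_range,
    Finset.card_range]

theorem stmt17 (d k : ℕ) (hd : 4 ≤ d) (hk2 : 2 ≤ k) (hkd : 2 * k ≤ d) (f : S)
    (hf : f = X 0 ^ d - X 1 ^ (d - k) * X 2 ^ k) :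
    NearlyFree f ∧
    (∀ j : ℕ, (d - 2 ≤ j ∧ j ≤ 2 * d - 4 → ndim f j = 1) ∧
      ((j < d - 2 ∨ 2 * d - 4 < j) → ndim f j = 0)) ∧
    TjurinaIs f ((d - 1) * (d - 2)) := by
  have hN := ndim_eq d k hd hk2 hkd f hf
  refine ⟨⟨?_, ?_⟩, hN, 3 * d, fun j hj => mdim_eq d k hd hk2 hkd f hf j hj⟩
  · intro h
    have h1 := (hN (d - 2)).1 ⟨le_rfl, by omega⟩
    have hb : Nsub f (d - 2) = ⊥ := by
      rw [eq_bot_iff]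
      rintro _ ⟨u, hu, rfl⟩
      have : quotC f u ∈ Nmod f := ⟨u, hu.1, rfl⟩
      rw [h] at this
      exact this
    rw [ndim, hb, finrank_bot] at h1
    exact absurd h1 (by norm_num)
  · intro j
    by_cases hj : d - 2 ≤ j ∧ j ≤ 2 * d - 4
    · exact ((hN j).1 hj).le
    · rw [(hN j).2 (by omega)]; norm_num

end
end

section
/- For integers d ≥ 4 and 2 ≤ k ≤ d/2, the polynomial f = x^d − y^{d−k}z^k ∈ ℂ[x,y,z] is squarefree and the number of its irreducible factors, counted without multiplicity (i.e. the number of pairwise non-associated irreducible polynomials dividing f), equals the greatest common divisor gcd(d, k); equivalently, the plane curve C : f = 0 has exactly gcd(d, k) irreducible components. -/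
open MvPolynomial

noncomputable section

/-- The parametrization of the binomial curve. -/
def parMap (a b c : ℕ) (w : ℂ) : S →ₐ[ℂ] S :=
  aeval ![C w * X 1 ^ c * X 2 ^ b, X 1 ^ a, X 2 ^ a]

/-- Its effect on exponents. -/
def parExp (a b c : ℕ) (m : Fin 3 →₀ ℕ) : Fin 3 →₀ ℕ :=
  Finsupp.single 1 (c * m 0 + a * m 1) + Finsupp.single 2 (b * m 0 + a * m 2)

lemma mono_eq (m : Fin 3 →₀ ℕ) (r : ℂ) :
    (monomial m r : S) = C r * (X 0 ^ m 0 * X 1 ^ m 1 * X 2 ^ m 2) := by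
  rw [monomial_eq, Finsupp.prod_fintype _ _ (by simp), Fin.prod_univ_three]

lemma parMap_mono (a b c : ℕ) (w : ℂ) (m : Fin 3 →₀ ℕ) (r : ℂ) :
    parMap a b c w (monomial m r) = monomial (parExp a b c m) (r * w ^ m 0) := by
  rw [mono_eq, mono_eq]
  simp [parMap, parExp, algebraMap_eq]
  ring

lemma parExp_inj (a b c : ℕ) (hab : Nat.Coprime a b) (m n : Fin 3 →₀ ℕ)
    (hm : m 0 < a) (hn : n 0 < a) (h : parExp a b c m = parExp a b c n) : m = n := by
  have h1 := DFunLike.congr_fun h 1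
  have h2 := DFunLike.congr_fun h 2
  simp [parExp] at h1 h2
  have ha : 0 < a := by omega
  have e0 : m 0 = n 0 := by
    have : b * m 0 ≡ b * n 0 [MOD a] := by
      have := congrArg (· % a) h2
      simpa [Nat.ModEq] using this
    have := Nat.ModEq.cancel_left_of_coprime (by simpa using hab) this
    exact Nat.ModEq.eq_of_lt_of_lt this hm hn
  rw [e0] at h1 h2
  have e1 : m 1 = n 1 := Nat.eq_of_mul_eq_mul_left ha (by omega)
  have e2 : m 2 = n 2 := Nat.eq_of_mul_eq_mul_left ha (by omega)
  ext i
  fin_cases i <;> assumption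

lemma reduce (a b c : ℕ) (ha : 0 < a) (z : ℂ) (p : S) :
    ∃ r : S, (∀ m ∈ r.support, m 0 < a) ∧
      (X 0 ^ a - C z * (X 1 ^ c * X 2 ^ b) : S) ∣ p - r := by
  classical
  induction p using MvPolynomial.induction_on' with
  | monomial e u =>
    refine ⟨monomial (Finsupp.equivFunOnFinite.symm
      ![e 0 % a, e 1 + c * (e 0 / a), e 2 + b * (e 0 / a)]) (u * z ^ (e 0 / a)), ?_, ?_⟩
    · intro m hm
      have := support_monomial_subset hm
      rw [Finset.mem_singleton] at this
      subst this
      simpa using Nat.mod_lt _ ha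
    · have := sub_dvd_pow_sub_pow (X 0 ^ a : S) (C z * (X 1 ^ c * X 2 ^ b)) (e 0 / a)
      refine (this.mul_right (C u * (X 0 ^ (e 0 % a) * X 1 ^ e 1 * X 2 ^ e 2))).trans
        (dvd_of_eq ?_)
      rw [mono_eq, mono_eq]
      simp only [Finsupp.equivFunOnFinite_symm_apply_apply, Matrix.cons_val]
      have hX : (X 0 ^ e 0 : S) = X 0 ^ (e 0 % a) * (X 0 ^ a) ^ (e 0 / a) := by
        rw [← pow_mul, ← pow_add, Nat.mod_add_div]
      rw [hX]
      simp only [map_mul, map_pow, pow_add, pow_mul]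
      ring
  | add p q hp hq =>
    obtain ⟨r, hr, hr'⟩ := hp
    obtain ⟨s, hs, hs'⟩ := hq
    refine ⟨r + s, ?_, ?_⟩
    · intro m hm
      rcases Finset.mem_union.1 (support_add hm) with h | h
      · exact hr m h
      · exact hs m h
    · rw [add_sub_add_comm]
      exact dvd_add hr' hs'

lemma par_reduced (a b c : ℕ) (hab : Nat.Coprime a b) (w : ℂ) (hw : w ≠ 0) (r : S)
    (hr : ∀ m ∈ r.support, m 0 < a) (h : parMap a b c w r = 0) : r = 0 := by
  classical
  by_contra hne
  obtain ⟨n, hn⟩ := Finset.nonempty_of_ne_empty (mt support_eq_empty.1 hne)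
  rw [r.as_sum, map_sum] at h
  simp only [parMap_mono] at h
  have := congrArg (coeff (parExp a b c n)) h
  rw [coeff_sum, Finset.sum_eq_single n] at this
  · simp [hw] at this
    exact (mem_support_iff.1 hn) this
  · intro m hm hmn
    rw [coeff_monomial, if_neg]
    intro h
    exact hmn (parExp_inj a b c hab m n (hr m hm) (hr n hn) h)
  · exact fun h => (h hn).elim

lemma par_iff (a b c : ℕ) (ha : 0 < a) (hab : Nat.Coprime a b) (w : ℂ) (hw : w ≠ 0)
    (p : S) : (X 0 ^ a - C (w ^ a) * (X 1 ^ c * X 2 ^ b) : S) ∣ p ↔ parMap a b c w p = 0 := by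
  have h0 : parMap a b c w (X 0 ^ a - C (w ^ a) * (X 1 ^ c * X 2 ^ b)) = 0 := by
    simp [parMap, algebraMap_eq]
    ring
  constructor
  · rintro ⟨q, rfl⟩
    rw [map_mul, h0, zero_mul]
  · intro hp
    obtain ⟨r, hr, hd⟩ := reduce a b c ha (w ^ a) p
    have hr0 : r = 0 := by
      apply par_reduced a b c hab w hw r hr
      obtain ⟨q, hq⟩ := hd
      have := congrArg (parMap a b c w) hq
      rw [map_sub, map_mul, h0, hp] at this
      simpa using this
    simpa [hr0] using hd

lemma binom_prime (a b c : ℕ) (ha : 0 < a) (hab : Nat.Coprime a b) (hb : 0 < b)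
    (z : ℂ) (hz : z ≠ 0) :
    Prime (X 0 ^ a - C z * (X 1 ^ c * X 2 ^ b) : S) := by
  obtain ⟨w, rfl⟩ := IsAlgClosed.exists_pow_nat_eq z ha
  have hw : w ≠ 0 := by
    rintro rfl
    exact hz (zero_pow ha.ne')
  have key := par_iff a b c ha hab w hw
  refine ⟨?_, ?_, ?_⟩
  · intro h
    have := congrArg (eval ![1, 0, 0]) h
    simp [hb.ne'] at this
  · intro h
    have := (key 1).1 h.dvd
    simp at this
  · intro p q h
    rw [key, map_mul, mul_eq_zero] at h
    rwa [key, key]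

lemma binom_dvd (a b c : ℕ) (ha : 0 < a) (z z' : ℂ)
    (h : (X 0 ^ a - C z * (X 1 ^ c * X 2 ^ b) : S) ∣ X 0 ^ a - C z' * (X 1 ^ c * X 2 ^ b)) :
    z = z' := by
  obtain ⟨w, rfl⟩ := IsAlgClosed.exists_pow_nat_eq z ha
  obtain ⟨q, hq⟩ := h
  have := congrArg (eval ![w, 1, 1]) hq
  simp at this
  exact sub_eq_zero.1 this

theorem stmt18 (d k : ℕ) (hd : 4 ≤ d) (hk2 : 2 ≤ k) (hkd : 2 * k ≤ d) (f : S)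
    (hf : f = X 0 ^ d - X 1 ^ (d - k) * X 2 ^ k) :
    Squarefree f ∧
    ∃ t : Finset S, t.card = Nat.gcd d k ∧
      (∀ p ∈ t, Irreducible p ∧ p ∣ f) ∧
      (∀ p ∈ t, ∀ q ∈ t, p ≠ q → ¬ Associated p q) ∧
      (∀ q : S, Irreducible q → q ∣ f → ∃ p ∈ t, Associated p q) := by
  classical
  obtain ⟨g, hg⟩ : ∃ g, g = Nat.gcd d k := ⟨_, rfl⟩
  have hgpos : 0 < g := hg ▸ Nat.gcd_pos_of_pos_left _ (by omega)
  obtain ⟨a, b, hab, had, hbk⟩ : ∃ a b, Nat.Coprime a b ∧ d = a * g ∧ k = b * g := by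
    subst hg
    exact ⟨_, _, Nat.coprime_div_gcd_div_gcd hgpos,
      (Nat.div_mul_cancel (Nat.gcd_dvd_left d k)).symm,
      (Nat.div_mul_cancel (Nat.gcd_dvd_right d k)).symm⟩
  have ha : 0 < a := Nat.pos_of_ne_zero (by rintro rfl; omega)
  have hb : 0 < b := Nat.pos_of_ne_zero (by rintro rfl; omega)
  have hprim : IsPrimitiveRoot (C (Complex.exp (2 * Real.pi * Complex.I / g)) : S) g :=
    (Complex.isPrimitiveRoot_exp g hgpos.ne').map_of_injective (C_injective (Fin 3) ℂ)
  let F : S → S := fun ζ => X 0 ^ a - ζ * (X 1 ^ (a - b) * X 2 ^ b)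
  have hfF : f = ∏ ζ ∈ Polynomial.nthRootsFinset g (1 : S), F ζ := by
    rw [← hprim.pow_sub_pow_eq_prod_sub_mul _ _ hgpos, hf, mul_pow, ← pow_mul, ← pow_mul,
      ← pow_mul, Nat.sub_mul, ← had, ← hbk]
  have hC : ∀ ζ ∈ Polynomial.nthRootsFinset g (1 : S), ∃ z : ℂ, z ≠ 0 ∧ ζ = C z := by
    intro ζ hζ
    rw [Polynomial.mem_nthRootsFinset hgpos] at hζ
    obtain ⟨z, hz, h⟩ := isUnit_iff_eq_C_of_isReduced.1 (IsUnit.of_pow_eq_one hζ hgpos.ne')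
    exact ⟨z, hz.ne_zero, h⟩
  have hirr : ∀ ζ ∈ Polynomial.nthRootsFinset g (1 : S), Irreducible (F ζ) := by
    intro ζ hζ
    obtain ⟨z, hz, rfl⟩ := hC ζ hζ
    exact (binom_prime a b (a - b) ha hab hb z hz).irreducible
  have hdvd : ∀ ζ ∈ Polynomial.nthRootsFinset g (1 : S),
      ∀ ξ ∈ Polynomial.nthRootsFinset g (1 : S), F ζ ∣ F ξ → ζ = ξ := by
    intro ζ hζ ξ hξ h
    obtain ⟨z, hz, rfl⟩ := hC ζ hζ
    obtain ⟨y, hy, rfl⟩ := hC ξ hξ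
    rw [binom_dvd a b (a - b) ha z y h]
  refine ⟨?_, (Polynomial.nthRootsFinset g (1 : S)).image F, ?_, ?_, ?_, ?_⟩
  · rw [hfF]
    apply Finset.squarefree_prod_of_pairwise_isCoprime
    · intro ζ hζ ξ hξ hne
      exact ((hirr ζ hζ).isRelPrime_iff_not_dvd).2 fun h => hne (hdvd ζ hζ ξ hξ h)
    · exact fun ζ hζ => (hirr ζ hζ).squarefree
  · rw [Finset.card_image_of_injOn, hprim.card_nthRootsFinset, hg]
    intro ζ hζ ξ hξ h
    exact hdvd ζ hζ ξ hξ (dvd_of_eq h)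
  · intro p hp
    obtain ⟨ζ, hζ, rfl⟩ := Finset.mem_image.1 hp
    exact ⟨hirr ζ hζ, hfF ▸ Finset.dvd_prod_of_mem F hζ⟩
  · intro p hp q hq hne hass
    obtain ⟨ζ, hζ, rfl⟩ := Finset.mem_image.1 hp
    obtain ⟨ξ, hξ, rfl⟩ := Finset.mem_image.1 hq
    exact hne (congrArg F (hdvd ζ hζ ξ hξ hass.dvd))
  · intro q hq hqf
    rw [hfF] at hqf
    obtain ⟨ζ, hζ, h⟩ := (irreducible_iff_prime.1 hq).exists_mem_finset_dvd hqf
    exact ⟨F ζ, Finset.mem_image_of_mem F hζ, (hq.associated_of_dvd (hirr ζ hζ) h).symm⟩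

end
end
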